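/- arXiv:1804.05952 — 2 statements merged into one kernel-verified Lean document; each statement's English description precedes it below -/
import Mathlib

section
/- For all integers m ≥ 1 and k ≥ 2, ESO(m,k) ≥ B(m,k); that is, the minimum number of turns in which player A can force a win in the game A_{m,k} is at least the minimum number of turns in which player A can force an m-up-run in the game B_{m,k}. -/
open Set

/-- A point in the plane. -/
abbrev Pt : Type := ℝ × ℝ

/-- The point set `P` contains an `n`-up-run: `n` points with strictly increasing
`x`-coordinates and nondecreasing `y`-coordinates. -/
def HasUpRun (P : Set Pt) (n : ℕ) : Prop :=
  ∃ f : Fin n → Pt, (∀ i, f i ∈ P) ∧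
    StrictMono (fun i => (f i).1) ∧ Monotone (fun i => (f i).2)

/-- The point set `P` contains an `n`-down-run: `n` points with strictly increasing
`x`-coordinates and strictly decreasing `y`-coordinates. -/
def HasDownRun (P : Set Pt) (n : ℕ) : Prop :=
  ∃ f : Fin n → Pt, (∀ i, f i ∈ P) ∧
    StrictMono (fun i => (f i).1) ∧ StrictAnti (fun i => (f i).2)

/-- A strategy for player A: from the list of previously played points, choose
an x-coordinate. -/
abbrev AStrat : Type := List Pt → ℝ

/-- A strategy for player B: from the list of previously played points and the new
x-coordinate, choose a y-coordinate. -/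
abbrev BStrat : Type := List Pt → ℝ → ℝ

/-- Validity of a strategy for player A in either game: the chosen x-coordinate lies in
`(0,1)` and is distinct from all previously played x-coordinates. -/
def AValid (sA : AStrat) : Prop :=
  ∀ h : List Pt, sA h ∈ Ioo (0:ℝ) 1 ∧ ∀ p ∈ h, sA h ≠ p.1

/-- Validity of a strategy for player B in the game `A_{m,k}`: the chosen y-coordinate
lies in `(0,1)` and is distinct from all previously played y-coordinates. -/
def BValid (sB : BStrat) : Prop :=
  ∀ (h : List Pt) (x : ℝ), sB h x ∈ Ioo (0:ℝ) 1 ∧ ∀ p ∈ h, sB h x ≠ p.2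

/-- The list of points played in the first `n` turns when A plays `sA` and B plays `sB`. -/
def hist (sA : AStrat) (sB : BStrat) : ℕ → List Pt
  | 0 => []
  | n + 1 =>
      let h := hist sA sB n
      h ++ [(sA h, sB h (sA h))]

/-- The set of points played in the first `N` turns. -/
def played (sA : AStrat) (sB : BStrat) (N : ℕ) : Set Pt :=
  {p | p ∈ hist sA sB N}

/-- In the game `A_{m,k}`, strategy `sA` of player A is valid and guarantees an
`m`-up-run or a `k`-down-run among the first `N` points, against every valid
strategy of player B. -/
def AWinsBy (m k N : ℕ) (sA : AStrat) : Prop :=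
  AValid sA ∧ ∀ sB : BStrat, BValid sB →
    HasUpRun (played sA sB N) m ∨ HasDownRun (played sA sB N) k

/-- The Erdős–Szekeres on-line number `ESO(m,k)`: the least `N` such that player A
has a strategy forcing an `m`-up-run or a `k`-down-run within `N` turns. -/
noncomputable def ESO (m k : ℕ) : ℕ := sInf {N | ∃ sA : AStrat, AWinsBy m k N sA}

/-- Validity of a strategy for player B in the tier game `B_{m,k}`: the chosen
y-coordinate is an integer in `{1, …, k-1}` (repetitions allowed). -/
def BTierValid (k : ℕ) (sB : BStrat) : Prop :=
  ∀ (h : List Pt) (x : ℝ), ∃ j : ℕ, 1 ≤ j ∧ j ≤ k - 1 ∧ sB h x = (j : ℝ)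

/-- In the tier game `B_{m,k}`, strategy `sA` of player A is valid and guarantees an
`m`-up-run among the first `N` points, against every valid strategy of player B. -/
def AWinsTierBy (m k N : ℕ) (sA : AStrat) : Prop :=
  AValid sA ∧ ∀ sB : BStrat, BTierValid k sB → HasUpRun (played sA sB N) m

/-- `B(m,k)`: the least `N` such that player A has a strategy forcing an `m`-up-run
within `N` turns of the tier game `B_{m,k}`. -/
noncomputable def BNum (m k : ℕ) : ℕ := sInf {N | ∃ sA : AStrat, AWinsTierBy m k N sA}

/-- A finite list of reals misses a point of the open unit interval. -/
theorem exists_mem_Ioo_notMem_list (l : List ℝ) : ∃ x ∈ Ioo (0 : ℝ) 1, x ∉ l := by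
  obtain ⟨x, hx, hxl⟩ := (Ioo_infinite (zero_lt_one' ℝ)).exists_notMem_finset l.toFinset
  exact ⟨x, hx, by simpa using hxl⟩

/-- A chosen point of the open unit interval outside a given list. -/
noncomputable def freshPoint (l : List ℝ) : ℝ := (exists_mem_Ioo_notMem_list l).choose

theorem freshPoint_mem_Ioo (l : List ℝ) : freshPoint l ∈ Ioo (0 : ℝ) 1 :=
  (exists_mem_Ioo_notMem_list l).choose_spec.1

theorem freshPoint_notMem (l : List ℝ) : freshPoint l ∉ l :=
  (exists_mem_Ioo_notMem_list l).choose_spec.2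

theorem aValid_freshPoint : AValid fun h => freshPoint (h.map Prod.fst) := fun h =>
  ⟨freshPoint_mem_Ioo _, fun _ hp he =>
    freshPoint_notMem (h.map Prod.fst) (List.mem_map.2 ⟨_, hp, he.symm⟩)⟩

theorem length_hist (sA : AStrat) (sB : BStrat) (n : ℕ) : (hist sA sB n).length = n := by
  induction n with
  | zero => rfl
  | succ n ih => simp [hist, ih]

theorem AValid.nodup_map_fst_hist {sA : AStrat} (hA : AValid sA) (sB : BStrat) (n : ℕ) :
    ((hist sA sB n).map Prod.fst).Nodup := by
  induction n with
  | zero => simp [hist]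
  | succ n ih =>
    simp only [hist, List.map_append, List.map_cons, List.map_nil]
    refine List.nodup_append.2 ⟨ih, by simp, ?_⟩
    rintro a ha b hb
    obtain ⟨p, hp, rfl⟩ := List.mem_map.1 ha
    rw [List.mem_singleton.1 hb]
    exact ((hA _).2 p hp).symm

/-- A set of more than `k` points with distinct `x`-coordinates, no two of which form an
up-run, contains a down-run of `k + 1` points. -/
theorem hasDownRun_of_antichain {S : Finset Pt} {k : ℕ} (hinj : InjOn Prod.fst (S : Set Pt))
    (hanti : ∀ p ∈ S, ∀ q ∈ S, p.1 < q.1 → q.2 < p.2) (hcard : k < S.card) :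
    HasDownRun S (k + 1) := by
  classical
  have hc : k + 1 ≤ (S.image Prod.fst).card := by rwa [Finset.card_image_of_injOn hinj]
  let e := (S.image Prod.fst).orderEmbOfCardLe hc
  have he : ∀ i, ∃ p ∈ S, p.1 = e i := fun i =>
    Finset.mem_image.1 ((S.image Prod.fst).orderEmbOfCardLe_mem hc i)
  choose f hfS hf using he
  have hmono : StrictMono fun i => (f i).1 := fun i j hij => by
    simpa only [hf] using e.strictMono hij
  exact ⟨f, hfS, hmono, fun i j hij => hanti _ (hfS i) _ (hfS j) (hmono hij)⟩

/-- The Erdős–Szekeres theorem for finite point sets with distinct `x`-coordinates. -/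
theorem hasUpRun_or_hasDownRun (m k : ℕ) (S : Finset Pt)
    (hinj : InjOn Prod.fst (S : Set Pt)) (hcard : m * k < S.card) :
    HasUpRun S (m + 1) ∨ HasDownRun S (k + 1) := by
  classical
  induction m generalizing S with
  | zero =>
    obtain ⟨p, hp⟩ := Finset.card_pos.1 (by simpa using hcard)
    exact Or.inl ⟨fun _ => p, fun _ => hp, fun i j hij => absurd hij (by omega), monotone_const⟩
  | succ m ih =>
    let M := S.filter fun p => ∀ q ∈ S, q.1 < p.1 → p.2 < q.2
    have hMS : M ⊆ S := Finset.filter_subset _ _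
    by_cases hM : k < M.card
    · obtain ⟨f, hf, h⟩ := hasDownRun_of_antichain (hinj.mono (Finset.coe_subset.2 hMS))
        (fun p hp q hq => (Finset.mem_filter.1 hq).2 p (hMS hp)) hM
      exact Or.inr ⟨f, fun i => hMS (hf i), h⟩
    have hle : m * k < (S \ M).card := by
      rw [Finset.card_sdiff_of_subset hMS]
      rw [add_mul, one_mul] at hcard
      omega
    have hsub : S \ M ⊆ S := Finset.sdiff_subset
    rcases ih (S \ M) (hinj.mono (Finset.coe_subset.2 hsub)) hle with
      ⟨f, hf, hfx, hfy⟩ | ⟨f, hf, h⟩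
    · obtain ⟨h0S, h0M⟩ := Finset.mem_sdiff.1 (hf 0)
      obtain ⟨q, hqS, hqx, hqy⟩ : ∃ q ∈ S, q.1 < (f 0).1 ∧ q.2 ≤ (f 0).2 := by
        by_contra! hcon
        exact h0M (Finset.mem_filter.2 ⟨h0S, hcon⟩)
      refine Or.inl ⟨Fin.cons q f, Fin.cases hqS fun i => hsub (hf i), ?_, ?_⟩
      · exact Fin.strictMono_iff_lt_succ.2 (Fin.cases hqx fun i => hfx i.castSucc_lt_succ)
      · exact Fin.monotone_iff_le_succ.2 (Fin.cases hqy fun i => hfy i.castSucc_lt_succ.le)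
    · exact Or.inr ⟨f, fun i => hsub (hf i), h⟩

/-- Every valid strategy of player A eventually wins the game `A_{m+1,k+1}`. -/
theorem AValid.aWinsBy {sA : AStrat} (hA : AValid sA) (m k : ℕ) :
    AWinsBy (m + 1) (k + 1) (m * k + 1) sA := by
  classical
  refine ⟨hA, fun sB _ => ?_⟩
  have hnd := hA.nodup_map_fst_hist sB (m * k + 1)
  have hS : ((hist sA sB (m * k + 1)).toFinset : Set Pt) = played sA sB (m * k + 1) := by
    ext p
    simp [played]
  rw [← hS]
  refine hasUpRun_or_hasDownRun m k _ ?_ ?_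
  · intro p hp q hq h
    exact List.inj_on_of_nodup_map hnd (by simpa using hp) (by simpa using hq) h
  · rw [List.toFinset_card_of_nodup hnd.of_map, length_hist]
    exact Nat.lt_succ_self _

/-- The affine embedding sending tier `j ∈ {1, …, n}` over `(0,1)` to an increasing segment in
the horizontal strip `((j - 1) / n, j / n)`. -/
noncomputable def tierEmbed (n : ℕ) (p : Pt) : Pt := (p.1, (p.2 - 1 + p.1) / n)

/-- The inverse of `tierEmbed`. -/
noncomputable def tierProject (n : ℕ) (p : Pt) : Pt := (p.1, n * p.2 - p.1 + 1)

theorem tierProject_tierEmbed {n : ℕ} (hn : n ≠ 0) (p : Pt) :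
    tierProject n (tierEmbed n p) = p := by
  have : (n : ℝ) ≠ 0 := Nat.cast_ne_zero.2 hn
  ext
  · rfl
  · simp only [tierProject, tierEmbed]
    field_simp
    ring

/-- The points over `(0,1)` lying in one of the tiers `1, …, n`. -/
def tierPoints (n : ℕ) : Set Pt :=
  {p | p.1 ∈ Ioo (0 : ℝ) 1 ∧ ∃ j : ℕ, 1 ≤ j ∧ j ≤ n ∧ p.2 = j}

theorem snd_tierEmbed_mem_Ioo {n : ℕ} {p : Pt} (hp : p ∈ tierPoints n) :
    (tierEmbed n p).2 ∈ Ioo (0 : ℝ) 1 := by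
  obtain ⟨⟨h0, h1⟩, j, hj1, hjn, hj⟩ := hp
  have hj1' : (1 : ℝ) ≤ j := by exact_mod_cast hj1
  have hjn' : (j : ℝ) ≤ n := by exact_mod_cast hjn
  have hn : (0 : ℝ) < n := by linarith
  constructor
  · exact div_pos (by linarith) hn
  · exact (div_lt_one hn).2 (by linarith)

/-- Comparing heights of embedded points compares tiers. -/
theorem snd_le_of_tierEmbed_le {n : ℕ} {p q : Pt} (hp : p ∈ tierPoints n)
    (hq : q ∈ tierPoints n) (h : (tierEmbed n p).2 ≤ (tierEmbed n q).2) : p.2 ≤ q.2 := by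
  obtain ⟨⟨hp0, hp1⟩, i, hi1, hin, hi⟩ := hp
  obtain ⟨⟨hq0, hq1⟩, j, hj1, hjn, hj⟩ := hq
  have hn : (0 : ℝ) < n := by exact_mod_cast hi1.trans hin
  have h' := (div_le_div_iff_of_pos_right hn).1 h
  rw [hi, hj] at h' ⊢
  have : (i : ℝ) < (j + 1 : ℕ) := by
    push_cast
    linarith
  exact_mod_cast Nat.lt_succ_iff.1 (Nat.cast_lt.1 this)

theorem fst_eq_of_snd_tierEmbed_eq {n : ℕ} {p q : Pt} (hp : p ∈ tierPoints n)
    (hq : q ∈ tierPoints n) (h : (tierEmbed n p).2 = (tierEmbed n q).2) : p.1 = q.1 := by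
  have h2 := (snd_le_of_tierEmbed_le hp hq h.le).antisymm (snd_le_of_tierEmbed_le hq hp h.ge)
  obtain ⟨-, i, hi1, hin, -⟩ := hp
  have hn : (n : ℝ) ≠ 0 := by
    have : n ≠ 0 := by omega
    exact_mod_cast this
  have h' := (div_left_inj' hn).1 h
  linarith

theorem HasUpRun.of_image_tierEmbed {n m : ℕ} {P : Set Pt} (hP : P ⊆ tierPoints n)
    (h : HasUpRun (tierEmbed n '' P) m) : HasUpRun P m := by
  obtain ⟨f, hf, hx, hy⟩ := h
  choose g hgP hg using hf
  obtain rfl : (fun i => tierEmbed n (g i)) = f := funext hg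
  exact ⟨g, hgP, hx, fun i j hij =>
    snd_le_of_tierEmbed_le (hP (hgP i)) (hP (hgP j)) (hy hij)⟩

theorem not_hasDownRun_image_tierEmbed {n : ℕ} {P : Set Pt} (hP : P ⊆ tierPoints n) :
    ¬ HasDownRun (tierEmbed n '' P) (n + 1) := by
  rintro ⟨f, hf, hx, hy⟩
  choose g hgP hg using hf
  obtain rfl : (fun i => tierEmbed n (g i)) = f := funext hg
  choose c hc1 hcn hc using fun i => (hP (hgP i)).2
  obtain ⟨i, -, j, -, hne, hij⟩ := Finset.exists_ne_map_eq_of_card_lt_of_maps_to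
    (s := Finset.univ) (t := Finset.Icc 1 n) (f := c) (by simp)
    (fun i _ => Finset.mem_coe.2 (Finset.mem_Icc.2 ⟨hc1 i, hcn i⟩))
  wlog hlt : i < j generalizing i j
  · exact this j i hne.symm hij.symm (hne.lt_or_gt.resolve_left hlt)
  have hn : (0 : ℝ) < n := by exact_mod_cast (hc1 i).trans (hcn i)
  have h1 : (g i).1 < (g j).1 := hx hlt
  have h2 := (div_lt_div_iff_of_pos_right hn).1 (hy hlt)
  rw [hc i, hc j, hij] at h2
  linarith

open Classical in
/-- The strategy for B in the game `A_{m,n+1}` that imitates the tier strategy `sB` through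
`tierEmbed`, playing an arbitrary legal move when the imitation is illegal. -/
noncomputable def liftTierStrat (n : ℕ) (sB : BStrat) : BStrat := fun h x =>
  let y := (tierEmbed n (x, sB (h.map (tierProject n)) x)).2
  if y ∈ Ioo (0 : ℝ) 1 ∧ ∀ p ∈ h, y ≠ p.2 then y else freshPoint (h.map Prod.snd)

theorem bValid_liftTierStrat (n : ℕ) (sB : BStrat) : BValid (liftTierStrat n sB) := by
  intro h x
  unfold liftTierStrat
  dsimp only
  split_ifs with hy
  · exact hy
  · exact ⟨freshPoint_mem_Ioo _, fun _ hp he =>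
      freshPoint_notMem (h.map Prod.snd) (List.mem_map.2 ⟨_, hp, he.symm⟩)⟩

theorem AValid.comp_tierEmbed {sA : AStrat} (hA : AValid sA) (n : ℕ) :
    AValid fun h => sA (h.map (tierEmbed n)) := fun _ =>
  ⟨(hA _).1, fun p hp => (hA _).2 (tierEmbed n p) (List.mem_map_of_mem hp)⟩

theorem AValid.played_subset_tierPoints {sA : AStrat} {sB : BStrat} {n : ℕ} (hA : AValid sA)
    (hB : BTierValid (n + 1) sB) (N : ℕ) : played sA sB N ⊆ tierPoints n := by
  induction N with
  | zero => simp [played, hist]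
  | succ N ih =>
    intro p hp
    rcases List.mem_append.1 hp with hp | hp
    · exact ih hp
    · rw [List.mem_singleton.1 hp]
      exact ⟨(hA _).1, hB _ _⟩

theorem AValid.hist_liftTierStrat {sA : AStrat} {sB : BStrat} {n : ℕ} (hn : n ≠ 0)
    (hA : AValid sA) (hB : BTierValid (n + 1) sB) (N : ℕ) :
    hist sA (liftTierStrat n sB) N =
      (hist (fun h => sA (h.map (tierEmbed n))) sB N).map (tierEmbed n) := by
  induction N with
  | zero => rfl
  | succ N ih =>
    have hA' := hA.comp_tierEmbed n
    have hsub : ∀ p ∈ hist _ sB N, p ∈ tierPoints n := fun _ hp =>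
      hA'.played_subset_tierPoints hB N hp
    simp only [hist, ih, List.map_append, List.map_cons, List.map_nil]
    generalize hist (fun h => sA (h.map (tierEmbed n))) sB N = l at *
    have hmap : (l.map (tierEmbed n)).map (tierProject n) = l := by
      simp [Function.comp_def, tierProject_tierEmbed hn]
    have hmem : (sA (l.map (tierEmbed n)), sB l (sA (l.map (tierEmbed n)))) ∈ tierPoints n :=
      ⟨(hA _).1, hB _ _⟩
    congr 2
    refine Prod.ext rfl ?_
    simp only [liftTierStrat, hmap]
    refine if_pos ⟨snd_tierEmbed_mem_Ioo hmem, fun p hp he => ?_⟩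
    obtain ⟨q, hq, rfl⟩ := List.mem_map.1 hp
    exact (hA' l).2 q hq (fst_eq_of_snd_tierEmbed_eq hmem (hsub q hq) he)

/-- A winning strategy of player A in `A_{m,n+1}` yields one in the tier game `B_{m,n+1}`. -/
theorem AWinsBy.aWinsTierBy {m n N : ℕ} {sA : AStrat} (hn : n ≠ 0)
    (h : AWinsBy m (n + 1) N sA) :
    AWinsTierBy m (n + 1) N fun h => sA (h.map (tierEmbed n)) := by
  refine ⟨h.1.comp_tierEmbed n, fun sB hB => ?_⟩
  have hsub := (h.1.comp_tierEmbed n).played_subset_tierPoints hB N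
  have himage : played sA (liftTierStrat n sB) N =
      tierEmbed n '' played (fun h => sA (h.map (tierEmbed n))) sB N := by
    ext p
    simp [played, h.1.hist_liftTierStrat hn hB]
  have hrun := h.2 _ (bValid_liftTierStrat n sB)
  rw [himage] at hrun
  exact (hrun.resolve_right (not_hasDownRun_image_tierEmbed hsub)).of_image_tierEmbed hsub

theorem BNum_le_ESO (m k : ℕ) (hm : 1 ≤ m) (hk : 2 ≤ k) :
    BNum m k ≤ ESO m k := by
  obtain ⟨m, rfl⟩ := Nat.exists_eq_add_of_le' hm
  obtain ⟨n, rfl⟩ := Nat.exists_eq_add_of_le' (one_le_two.trans hk)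
  have hne : {N | ∃ sA : AStrat, AWinsBy (m + 1) (n + 1) N sA}.Nonempty :=
    ⟨_, _, aValid_freshPoint.aWinsBy m n⟩
  obtain ⟨sA, hsA⟩ := Nat.sInf_mem hne
  exact Nat.sInf_le ⟨_, hsA.aWinsTierBy (by omega)⟩
end

section
/- Let P be a nonempty finite set of points in (0,1)×(0,1) with pairwise distinct x-coordinates and pairwise distinct y-coordinates, and let x̂ ∈ (0,1) be distinct from every x-coordinate of a point of P. Then there exists ŷ ∈ (0,1), distinct from every y-coordinate of a point of P, such that the maximum size of a down-run contained in P ∪ {(x̂,ŷ)} equals the maximum size of a down-run contained in P. -/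
open Set

/-- The maximum size of a down-run contained in the point set `P`. -/
noncomputable def maxDownRun (P : Set Pt) : ℕ := sSup {n | HasDownRun P n}

/-- `f` enumerates a down-run contained in `P`, from left to right. -/
def IsDownRun (P : Set Pt) {n : ℕ} (f : Fin n → Pt) : Prop :=
  (∀ i, f i ∈ P) ∧ StrictMono (fun i => (f i).1) ∧ StrictAnti (fun i => (f i).2)

lemma HasDownRun.of_le {P : Set Pt} {m n : ℕ} (h : HasDownRun P n) (hmn : m ≤ n) :
    HasDownRun P m := by
  obtain ⟨f, hf, hf₁, hf₂⟩ := h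
  exact ⟨fun i => f (Fin.castLE hmn i), fun i => hf _,
    fun i j hij => hf₁ (Fin.castLE_lt_castLE_iff hmn |>.2 hij),
    fun i j hij => hf₂ (Fin.castLE_lt_castLE_iff hmn |>.2 hij)⟩

lemma HasDownRun.mono {P Q : Set Pt} {n : ℕ} (h : HasDownRun P n) (hPQ : P ⊆ Q) :
    HasDownRun Q n := by
  obtain ⟨f, hf, hf'⟩ := h
  exact ⟨f, fun i => hPQ (hf i), hf'⟩

lemma HasDownRun.le_card {P : Finset Pt} {n : ℕ} (h : HasDownRun P n) : n ≤ P.card := by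
  obtain ⟨f, hf, hf₁, -⟩ := h
  have hinj : Function.Injective f := fun i j hij => hf₁.injective (congrArg Prod.fst hij)
  simpa using Finset.card_le_card_of_injOn f (s := Finset.univ) (t := P)
    (fun i _ => hf i) hinj.injOn

lemma HasDownRun.one {P : Set Pt} {p : Pt} (hp : p ∈ P) : HasDownRun P 1 :=
  ⟨fun _ => p, fun _ => hp, Subsingleton.strictMono _, Subsingleton.strictAnti _⟩

/-- A down-run can be prolonged by a point to the lower right of its last point. -/
lemma IsDownRun.snoc {P : Set Pt} {m : ℕ} {g : Fin (m + 1) → Pt} (hg : IsDownRun P g) {q : Pt}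
    (hq : q ∈ P) (h₁ : (g (Fin.last m)).1 < q.1) (h₂ : q.2 < (g (Fin.last m)).2) :
    HasDownRun P (m + 2) := by
  obtain ⟨hgP, hg₁, hg₂⟩ := hg
  refine ⟨Fin.snoc (α := fun _ => Pt) g q, fun i => ?_, ?_, ?_⟩
  · induction i using Fin.lastCases with
    | last => simpa using hq
    | cast i => simpa using hgP i
  · refine Fin.strictMono_iff_lt_succ.2 fun i => ?_
    induction i using Fin.lastCases with
    | last => simpa using h₁
    | cast i =>
      rw [Fin.succ_castSucc]
      simpa only [Fin.snoc_castSucc] using hg₁ i.castSucc_lt_succ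
  · refine Fin.strictAnti_iff_succ_lt.2 fun i => ?_
    induction i using Fin.lastCases with
    | last => simpa using h₂
    | cast i =>
      rw [Fin.succ_castSucc]
      simpa only [Fin.snoc_castSucc] using hg₂ i.castSucc_lt_succ

/-- The maximum size of a down-run in a finite set is attained. -/
lemma exists_isGreatest_hasDownRun {P : Finset Pt} (hne : P.Nonempty) :
    ∃ m : ℕ, IsGreatest {n | HasDownRun P n} (m + 1) := by
  obtain ⟨p, hp⟩ := hne
  have h1 : HasDownRun P 1 := .one (Finset.mem_coe.2 hp)
  have hbdd : BddAbove {n | HasDownRun (P : Set Pt) n} := ⟨P.card, fun _ h => h.le_card⟩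
  have hpos : 1 ≤ sSup {n | HasDownRun (P : Set Pt) n} := le_csSup hbdd h1
  refine ⟨sSup {n | HasDownRun (P : Set Pt) n} - 1, ?_⟩
  rw [Nat.sub_add_cancel hpos]
  exact ⟨Nat.sSup_mem ⟨1, h1⟩ hbdd, fun _ h => le_csSup hbdd h⟩

/-- The highest endpoint of the down-runs of size `m + 1` lying to the left of `x`
(or `0` if there is none). -/
lemma exists_highest_endpoint {P : Finset Pt} (hmem : ∀ p ∈ P, p.2 ∈ Ioo (0 : ℝ) 1)
    (x : ℝ) (m : ℕ) :
    ∃ t ∈ Ico (0 : ℝ) 1,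
      (t = 0 ∨ ∃ g : Fin (m + 1) → Pt, IsDownRun P g ∧ (g (Fin.last m)).1 < x ∧
        (g (Fin.last m)).2 = t) ∧
      ∀ g : Fin (m + 1) → Pt, IsDownRun P g → (g (Fin.last m)).1 < x →
        (g (Fin.last m)).2 ≤ t := by
  classical
  set T := P.filter fun p => ∃ g : Fin (m + 1) → Pt, IsDownRun P g ∧ (g (Fin.last m)).1 < x ∧
    g (Fin.last m) = p with hT
  have hmemT : ∀ g : Fin (m + 1) → Pt, IsDownRun P g → (g (Fin.last m)).1 < x →
      g (Fin.last m) ∈ T := fun g hg hgx =>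
    Finset.mem_filter.2 ⟨hg.1 _, g, hg, hgx, rfl⟩
  rcases T.eq_empty_or_nonempty with he | hne
  · refine ⟨0, by simp, Or.inl rfl, fun g hg hgx => ?_⟩
    simpa [he] using hmemT g hg hgx
  · obtain ⟨p, hp, hmax⟩ := T.exists_max_image Prod.snd hne
    obtain ⟨hpP, g, hg, hgx, rfl⟩ := Finset.mem_filter.1 hp
    exact ⟨_, Ioo_subset_Ico_self (hmem _ hpP), Or.inr ⟨g, hg, hgx, rfl⟩,
      fun g' hg' hgx' => hmax _ (hmemT g' hg' hgx')⟩

/-- There is room just above `t` avoiding the heights of a finite point set. -/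
lemma exists_just_above (P : Finset Pt) {t : ℝ} (ht : t < 1) :
    ∃ y ∈ Ioo t 1, ∀ p ∈ P, t < p.2 → y < p.2 := by
  have h : ∀ᶠ y in nhdsWithin t (Ioi t), ∀ p ∈ P, t < p.2 → y < p.2 := by
    refine (Filter.eventually_all_finset P).2 fun p _ => ?_
    by_cases hp : t < p.2
    · filter_upwards [Ioo_mem_nhdsGT hp] with y hy _ using hy.2
    · exact Filter.Eventually.of_forall fun y h => absurd h hp
  obtain ⟨y, hy, hyP⟩ := ((Filter.eventually_mem_set.2 (Ioo_mem_nhdsGT ht)).and h).exists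
  exact ⟨y, hy, hyP⟩

theorem exists_y_not_increasing_maxDownRun (P : Finset Pt) (hne : P.Nonempty)
    (hmem : ∀ p ∈ P, p.1 ∈ Ioo (0:ℝ) 1 ∧ p.2 ∈ Ioo (0:ℝ) 1)
    (hx : ∀ p ∈ P, ∀ q ∈ P, p ≠ q → p.1 ≠ q.1)
    (hy : ∀ p ∈ P, ∀ q ∈ P, p ≠ q → p.2 ≠ q.2)
    (xh : ℝ) (hxh : xh ∈ Ioo (0:ℝ) 1) (hxh' : ∀ p ∈ P, xh ≠ p.1) :
    ∃ yh ∈ Ioo (0:ℝ) 1, (∀ p ∈ P, yh ≠ p.2) ∧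
      maxDownRun (↑P ∪ {(xh, yh)}) = maxDownRun ↑P := by
  obtain ⟨m, hm, hmax⟩ := exists_isGreatest_hasDownRun hne
  have hlong : ¬ HasDownRun (P : Set Pt) (m + 2) := fun h => absurd (hmax h) (by omega)
  obtain ⟨t, ⟨ht0, ht1⟩, ht, htmax⟩ :=
    exists_highest_endpoint (fun p hp => (hmem p hp).2) xh m
  obtain ⟨yh, ⟨hty, hy1⟩, hyP⟩ := exists_just_above P ht1
  refine ⟨yh, ⟨ht0.trans_lt hty, hy1⟩, fun p hp h => ?_, ?_⟩
  · exact (hyP p hp (h ▸ hty)).ne h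
  have hgreatest : IsGreatest {n | HasDownRun (↑P ∪ {(xh, yh)}) n} (m + 1) := by
    refine ⟨HasDownRun.mono hm subset_union_left, fun n hn => ?_⟩
    by_contra hlt
    obtain ⟨f, hf, hf₁, hf₂⟩ := HasDownRun.of_le (m := m + 2) hn (by omega)
    by_cases hnew : ∃ i, f i = (xh, yh)
    · obtain ⟨i, hi⟩ := hnew
      have hfP : ∀ j, j ≠ i → f j ∈ P := fun j hj =>
        (hf j).resolve_right fun h => hj (hf₁.injective (congrArg Prod.fst (h.trans hi.symm)))
      rcases (Fin.le_last i).eq_or_lt with rfl | hil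
      · have hrun : IsDownRun (P : Set Pt) (fun j : Fin (m + 1) => f j.castSucc) :=
          ⟨fun j => hfP _ j.castSucc_lt_last.ne, hf₁.comp Fin.strictMono_castSucc,
            hf₂.comp_strictMono Fin.strictMono_castSucc⟩
        have h₁ := hf₁ (Fin.last m).castSucc_lt_last
        have h₂ := hf₂ (Fin.last m).castSucc_lt_last
        simp only [hi] at h₁ h₂
        exact (htmax _ hrun h₁).not_gt (hty.trans h₂)
      · have hqP := hfP _ hil.ne'
        have h₁ := hf₁ hil
        have h₂ := hf₂ hil
        simp only [hi] at h₁ h₂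
        have hqt : (f (Fin.last (m + 1))).2 ≤ t := by
          by_contra! h
          exact h₂.not_gt (hyP _ hqP h)
        rcases ht with rfl | ⟨g, hg, hgx, rfl⟩
        · exact hqt.not_gt (hmem _ hqP).2.1
        · have hlt₁ := hgx.trans h₁
          refine hlong (hg.snoc hqP hlt₁ (hqt.lt_of_ne ?_))
          exact hy _ hqP _ (hg.1 _) fun h => hlt₁.ne' (congrArg Prod.fst h)
    · push Not at hnew
      exact hlong ⟨f, fun i => (hf i).resolve_right (hnew i), hf₁, hf₂⟩
  exact hgreatest.csSup_eq.trans (IsGreatest.csSup_eq ⟨hm, hmax⟩).symm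
end
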